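/- Let B > 0, C > 0, r ∈ [0,1), and p > 1. There is no twice continuously differentiable function Y : [0,∞) → ℝ satisfying Y''(t) + B·Y'(t) − C·(1+t)^{−r}·Y(t)^p ≥ 0 for all t ≥ 0 together with Y(0) > 0 and Y'(0) > 0. Equivalently, any such solution defined on [0,T) forces T < ∞. -/

import Mathlib

open Set Filter Topology in
/-- A function on `[0, ∞)` that starts positive stays positive if its derivative is positive
at any first point where it fails to be positive. -/
theorem pos_of_deriv_pos_of_first_nonpos {G G' : ℝ → ℝ}
    (hG : ∀ t, 0 ≤ t → HasDerivAt G (G' t) t) (h0 : 0 < G 0)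
    (h : ∀ t, 0 < t → (∀ s, 0 ≤ s → s < t → 0 < G s) → G t ≤ 0 → 0 < G' t)
    {t : ℝ} (ht : 0 ≤ t) : 0 < G t := by
  by_contra! hneg
  have hcont : ContinuousOn G (Icc 0 t) := fun x hx =>
    (hG x hx.1).continuousAt.continuousWithinAt
  have hcomp : IsCompact (Icc 0 t ∩ G ⁻¹' Iic 0) :=
    isCompact_Icc.of_isClosed_subset
      (hcont.preimage_isClosed_of_isClosed isClosed_Icc isClosed_Iic) inter_subset_left
  obtain ⟨τ, ⟨hτ, hGτ⟩, hmin⟩ := hcomp.exists_isLeast ⟨t, ⟨ht, le_rfl⟩, hneg⟩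
  have hGτ' : G τ ≤ 0 := hGτ
  have hτ0 : 0 < τ := lt_of_le_of_ne hτ.1 (by rintro rfl; linarith)
  have hpos : ∀ s, 0 ≤ s → s < τ → 0 < G s := by
    intro s hs hsτ
    by_contra! hs'
    exact (hmin ⟨⟨hs, hsτ.le.trans hτ.2⟩, hs'⟩).not_gt hsτ
  have hslope : ∀ᶠ s in 𝓝[<] τ, 0 < slope G τ s :=
    ((hasDerivAt_iff_tendsto_slope.1 (hG τ hτ.1)).mono_left
      (nhdsWithin_mono _ fun _ hx => ne_of_lt hx)).eventually_const_lt (h τ hτ0 hpos hGτ')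
  obtain ⟨s, hs, hs1⟩ := (hslope.and (Ioo_mem_nhdsLT hτ0)).exists
  rw [slope_def_field] at hs
  have hs2 := hpos s hs1.1.le hs1.2
  exact hs.not_gt (div_neg_of_pos_of_neg (by linarith) (by linarith [hs1.2]))

/-- A positive function cannot satisfy `Y' ≥ ε (1+t)^{-r} Y^q` on all of `[0, ∞)`
when `q > 1` and `r < 1`. -/
theorem false_of_rpow_le_deriv {r q ε : ℝ} (hr : r < 1) (hq : 1 < q) (hε : 0 < ε)
    {Y Y' : ℝ → ℝ} (hY : ∀ t, 0 ≤ t → HasDerivAt Y (Y' t) t) (hpos : ∀ t, 0 ≤ t → 0 < Y t)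
    (hle : ∀ t, 0 ≤ t → ε * (1 + t) ^ (-r) * Y t ^ q ≤ Y' t) : False := by
  set k := (q - 1) * ε / (1 - r) with hk
  have hkpos : 0 < k := div_pos (mul_pos (by linarith) hε) (by linarith)
  have hderiv : ∀ t, 0 ≤ t → HasDerivAt (fun t => Y t ^ (1 - q) + k * (1 + t) ^ (1 - r))
      (Y' t * (1 - q) * Y t ^ (1 - q - 1) + k * (1 * (1 - r) * (1 + t) ^ (1 - r - 1))) t := by
    intro t ht
    exact ((hY t ht).rpow_const (Or.inl (hpos t ht).ne')).add
      ((((hasDerivAt_id t).const_add 1).rpow_const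
        (Or.inl (by simp only [id]; positivity))).const_mul k)
  have hanti : AntitoneOn (fun t => Y t ^ (1 - q) + k * (1 + t) ^ (1 - r)) (Set.Ici 0) := by
    refine antitoneOn_of_hasDerivWithinAt_nonpos (convex_Ici 0)
      (fun t ht => (hderiv t ht).continuousAt.continuousWithinAt)
      (fun t ht => (hderiv t (interior_subset ht)).hasDerivWithinAt) ?_
    intro t ht
    have ht0 : 0 ≤ t := interior_subset ht
    have hYt := hpos t ht0
    have h1 : Y t ^ (1 - q - 1) * Y t ^ q = 1 := by
      rw [← Real.rpow_add hYt]; norm_num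
    have h2 : ε * (1 + t) ^ (-r) ≤ Y' t * Y t ^ (1 - q - 1) := by
      calc ε * (1 + t) ^ (-r) = ε * (1 + t) ^ (-r) * Y t ^ q * Y t ^ (1 - q - 1) := by
            linear_combination (-(ε * (1 + t) ^ (-r))) * h1
        _ ≤ _ := mul_le_mul_of_nonneg_right (hle t ht0) (by positivity)
    have h3 : k * (1 - r) = (q - 1) * ε := by
      rw [hk]; exact div_mul_cancel₀ _ (by linarith)
    have h4 : (1 - r - 1 : ℝ) = -r := by ring
    rw [h4]
    have h5 := mul_le_mul_of_nonneg_left h2 (by linarith : 0 ≤ q - 1)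
    linear_combination h5 + (1 + t) ^ (-r) * h3
  have htend : Filter.Tendsto (fun t : ℝ => k * (1 + t) ^ (1 - r)) Filter.atTop Filter.atTop :=
    ((tendsto_rpow_atTop (by linarith)).comp
      (Filter.tendsto_atTop_add_const_left _ 1 Filter.tendsto_id)).const_mul_atTop hkpos
  obtain ⟨t, ht, ht0⟩ := ((htend.eventually_gt_atTop (Y 0 ^ (1 - q) + k * (1 + 0) ^ (1 - r))).and
    (Filter.eventually_ge_atTop 0)).exists
  have h1 := hanti Set.self_mem_Ici ht0 ht0
  have h2 := Real.rpow_pos_of_pos (hpos t ht0) (1 - q)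
  simp only at h1
  linarith

/-- Lemma 3.5 (L4): there is no global-in-time `C²` solution of
`Y'' + B Y' - C (1+t)^{-r} Y^p ≥ 0` on `[0,∞)` with `Y(0) > 0`, `Y'(0) > 0`,
when `B, C > 0`, `r ∈ [0,1)` and `p > 1`. -/
theorem stmt_9 (B C r p : ℝ) (hB : 0 < B) (hC : 0 < C)
    (hr0 : 0 ≤ r) (hr1 : r < 1) (hp : 1 < p)
    (Y Y' Y'' : ℝ → ℝ)
    (hY1 : ∀ t : ℝ, 0 ≤ t → HasDerivAt Y (Y' t) t)
    (hY2 : ∀ t : ℝ, 0 ≤ t → HasDerivAt Y' (Y'' t) t)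
    (hY''_cont : ContinuousOn Y'' (Set.Ici (0:ℝ)))
    (hY0 : 0 < Y 0) (hY'0 : 0 < Y' 0)
    (hineq : ∀ t : ℝ, 0 ≤ t →
      0 ≤ Y'' t + B * Y' t - C * (1 + t) ^ (-r) * Y t ^ p) :
    False := by
  have hmono : ∀ t, 0 ≤ t → (∀ s, 0 ≤ s → s < t → 0 < Y' s) → Y 0 ≤ Y t := by
    intro t ht hs
    refine monotoneOn_of_hasDerivWithinAt_nonneg (convex_Icc 0 t) (f' := Y')
      (fun s hs => (hY1 s hs.1).continuousAt.continuousWithinAt)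
      (fun s hs => (hY1 s (interior_subset hs).1).hasDerivWithinAt) ?_
      (Set.left_mem_Icc.2 ht) (Set.right_mem_Icc.2 ht) ht
    intro s hs'
    rw [interior_Icc] at hs'
    exact (hs s hs'.1.le hs'.2).le
  have hY'pos : ∀ t, 0 ≤ t → 0 < Y' t := by
    intro t ht
    refine pos_of_deriv_pos_of_first_nonpos hY2 hY'0 ?_ ht
    intro s hs hpre hneg
    have hYs : 0 < Y s := hY0.trans_le (hmono s hs.le hpre)
    have h1 : 0 < C * (1 + s) ^ (-r) * Y s ^ p := by positivity
    have h2 := mul_nonneg hB.le (neg_nonneg.2 hneg)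
    linarith [hineq s hs.le]
  have hYge : ∀ t, 0 ≤ t → Y 0 ≤ Y t := fun t ht => hmono t ht fun s hs _ => hY'pos s hs
  have hYpos : ∀ t, 0 ≤ t → 0 < Y t := fun t ht => hY0.trans_le (hYge t ht)
  obtain ⟨q, hq⟩ : ∃ q, q = (p + 1) / 2 := ⟨_, rfl⟩
  have hq1 : 1 < q := by linarith
  set M := B * Y 0 ^ (q - p) + q with hM
  have hMpos : 0 < M := by positivity
  obtain ⟨ε, hε, hε1, hεC, hεY⟩ : ∃ ε : ℝ, 0 < ε ∧ ε ≤ 1 ∧ ε * M < C ∧ ε * Y 0 ^ q < Y' 0 := by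
    have hYq : 0 < Y 0 ^ q := by positivity
    obtain ⟨ε, h0, h1⟩ := exists_between
      (lt_min one_pos (lt_min (div_pos hC hMpos) (div_pos hY'0 hYq)))
    rw [lt_min_iff, lt_min_iff, lt_div_iff₀ hMpos, lt_div_iff₀ hYq] at h1
    exact ⟨ε, h0, h1.1.le, h1.2⟩
  have hGpos : ∀ t, 0 ≤ t → 0 < Y' t - ε * ((1 + t) ^ (-r) * Y t ^ q) := by
    intro t ht
    refine pos_of_deriv_pos_of_first_nonpos (G := fun t => Y' t - ε * ((1 + t) ^ (-r) * Y t ^ q))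
      (fun t ht => (hY2 t ht).sub
        (((((hasDerivAt_id t).const_add 1).rpow_const (p := -r)
          (Or.inl (by simp only [id]; positivity))).mul
            ((hY1 t ht).rpow_const (p := q) (Or.inl (hYpos t ht).ne'))).const_mul ε))
      (by simpa using hεY) ?_ ht
    intro s hs _ hneg
    simp only [id] at hneg ⊢
    have hs0 := hs.le
    have hYs := hYpos s hs0
    have hw1 : (1 + s) ^ (-r) ≤ 1 :=
      Real.rpow_le_one_of_one_le_of_nonpos (by linarith) (by linarith)
    have hw : 0 < (1 + s) ^ (-r) := by positivity
    have hw' : 0 ≤ r * (1 + s) ^ (-r - 1) := by positivity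
    have hin := hineq s hs0
    have hp1 : Y s ^ q ≤ Y 0 ^ (q - p) * Y s ^ p := by
      calc Y s ^ q = Y s ^ (q - p) * Y s ^ p := by rw [← Real.rpow_add hYs]; ring_nf
        _ ≤ _ := mul_le_mul_of_nonneg_right
          (Real.rpow_le_rpow_of_nonpos hY0 (hYge s hs0) (by linarith)) (by positivity)
    have hp2 : Y s ^ q * Y s ^ (q - 1) = Y s ^ p := by
      rw [← Real.rpow_add hYs]; congr 1; linarith
    have hP : 0 < Y s ^ p := by positivity
    have hQ : 0 < Y s ^ q := by positivity
    have hR : 0 < Y s ^ (q - 1) := by positivity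
    generalize (1 + s) ^ (-r) = w at *
    generalize (1 + s) ^ (-r - 1) = v at *
    generalize Y s ^ p = P at *
    generalize Y s ^ q = Q at *
    generalize Y s ^ (q - 1) = R at *
    have e1 : 0 ≤ (B + ε * w * q * R) * (ε * (w * Q) - Y' s) :=
      mul_nonneg (by positivity) (by linarith)
    have e2 : 0 ≤ ε * (r * v) * Q := by positivity
    have e3 : 0 ≤ ε * w * B * (Y 0 ^ (q - p) * P - Q) :=
      mul_nonneg (by positivity) (by linarith)
    have e4 : 0 < w * P * (C - ε * M) := mul_pos (by positivity) (by linarith)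
    have hεw : ε * w ≤ 1 := mul_le_one₀ hε1 hw.le hw1
    have e5 : 0 ≤ ε * w * q * P * (1 - ε * w) := mul_nonneg (by positivity) (by linarith)
    rw [hM] at e4
    linear_combination e1 + e2 + e3 + e4 + e5 + hin + ε ^ 2 * w ^ 2 * q * hp2
  refine false_of_rpow_le_deriv hr1 hq1 hε hY1 hYpos fun t ht => ?_
  linarith [hGpos t ht]
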